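/- Let E, F be real m×m matrices forming a regular matrix pencil with Weierstraß–Kronecker decomposition (d, L, K, W, N). Then the adjoint pair {−Eᵀ, Fᵀ} is also a regular matrix pencil, and a Weierstraß–Kronecker decomposition of {−Eᵀ, Fᵀ} is given by (d, L̃, K̃, W̃, Ñ) with L̃ := blockDiag(−I_d, I_{m−d})·Kᵀ, K̃ := Lᵀ, W̃ := −Wᵀ, and Ñ := −Nᵀ; i.e. L̃·(−Eᵀ)·K̃ = blockDiag(I_d, −Nᵀ) with −Nᵀ nilpotent, and L̃·Fᵀ·K̃ = blockDiag(−Wᵀ, I_{m−d}). In particular the adjoint pair is regular with the same value of d and the same nilpotency index, and its canonical subspaces are S_{*can} = span of the first d columns of Lᵀ and N_{*can} = span of the last m−d columns of Lᵀ. -/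

import Mathlib

open Matrix

/-- The block-diagonal `m × m` matrix with blocks `A` (of size `d`) and `B` (of size `e`),
where `d + e = m`. -/
def blockDiag {d e m : ℕ} (h : d + e = m)
    (A : Matrix (Fin d) (Fin d) ℝ) (B : Matrix (Fin e) (Fin e) ℝ) :
    Matrix (Fin m) (Fin m) ℝ :=
  Matrix.reindex (finSumFinEquiv.trans (finCongr h)) (finSumFinEquiv.trans (finCongr h))
    (Matrix.fromBlocks A 0 0 B)

/-- The pair `{E,F}` is a regular matrix pencil: the polynomial `λ ↦ det (λ•E + F)`
does not vanish identically. -/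
def RegularPencil {m : ℕ} (E F : Matrix (Fin m) (Fin m) ℝ) : Prop :=
  ¬ ∀ c : ℝ, (c • E + F).det = 0

/-- A Weierstraß–Kronecker decomposition of the pair `{E,F}`:
`L·E·K = blockDiag (I_d, N)` and `L·F·K = blockDiag (W, I_{m-d})`, with `L, K` invertible
and `N` nilpotent. -/
structure WKDecomp (m : ℕ) (E F : Matrix (Fin m) (Fin m) ℝ) where
  d : ℕ
  e : ℕ
  hde : d + e = m
  L : Matrix (Fin m) (Fin m) ℝ
  K : Matrix (Fin m) (Fin m) ℝ
  hL : IsUnit L.det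
  hK : IsUnit K.det
  W : Matrix (Fin d) (Fin d) ℝ
  N : Matrix (Fin e) (Fin e) ℝ
  hN : IsNilpotent N
  hE : L * E * K = blockDiag hde 1 N
  hF : L * F * K = blockDiag hde W 1

variable {m : ℕ} {E F : Matrix (Fin m) (Fin m) ℝ}

/-- The canonical subspace `S_can`: the span of the first `d` columns of `K`. -/
def WKDecomp.Scan (w : WKDecomp m E F) : Submodule ℝ (Fin m → ℝ) :=
  Submodule.span ℝ
    (Set.range fun j : Fin w.d => w.K.transpose (finCongr w.hde (Fin.castAdd w.e j)))

/-- The canonical subspace `N_can`: the span of the last `m - d` columns of `K`. -/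
def WKDecomp.Ncan (w : WKDecomp m E F) : Submodule ℝ (Fin m → ℝ) :=
  Submodule.span ℝ
    (Set.range fun j : Fin w.e => w.K.transpose (finCongr w.hde (Fin.natAdd w.d j)))

theorem blockDiag_mul_blockDiag {d e n : ℕ} (h : d + e = n)
    (A A' : Matrix (Fin d) (Fin d) ℝ) (B B' : Matrix (Fin e) (Fin e) ℝ) :
    _root_.blockDiag h A B * _root_.blockDiag h A' B' =
      _root_.blockDiag h (A * A') (B * B') := by
  simp only [_root_.blockDiag, Matrix.reindex_apply, Matrix.submatrix_mul_equiv,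
    Matrix.fromBlocks_multiply]
  simp

theorem blockDiag_one_one {d e n : ℕ} (h : d + e = n) :
    _root_.blockDiag h 1 1 = 1 := by
  rw [_root_.blockDiag, Matrix.fromBlocks_one, Matrix.reindex_apply, Matrix.submatrix_one_equiv]

theorem transpose_blockDiag {d e n : ℕ} (h : d + e = n)
    (A : Matrix (Fin d) (Fin d) ℝ) (B : Matrix (Fin e) (Fin e) ℝ) :
    (_root_.blockDiag h A B)ᵀ = _root_.blockDiag h Aᵀ Bᵀ := by
  simp [_root_.blockDiag, Matrix.fromBlocks_transpose]

theorem neg_blockDiag {d e n : ℕ} (h : d + e = n)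
    (A : Matrix (Fin d) (Fin d) ℝ) (B : Matrix (Fin e) (Fin e) ℝ) :
    -_root_.blockDiag h A B = _root_.blockDiag h (-A) (-B) := by
  have hneg := Matrix.fromBlocks_neg A 0 0 B
  rw [neg_zero, neg_zero] at hneg
  rw [_root_.blockDiag, _root_.blockDiag, ← hneg]
  rfl

theorem isUnit_det_blockDiag_neg_one_one {d e n : ℕ} (h : d + e = n) :
    IsUnit (_root_.blockDiag h (-1) 1).det :=
  Matrix.isUnit_det_of_left_inverse (B := _root_.blockDiag h (-1) 1) <| by
    simp [blockDiag_mul_blockDiag, blockDiag_one_one]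

theorem RegularPencil.neg_transpose {n : ℕ} {A B : Matrix (Fin n) (Fin n) ℝ}
    (h : RegularPencil A B) : RegularPencil (-Aᵀ) Bᵀ := fun h0 => h fun c => by
  rw [← Matrix.det_transpose]
  simpa using h0 (-c)

theorem neg_transpose_pow_eq_zero_iff {e : ℕ} (N : Matrix (Fin e) (Fin e) ℝ) (k : ℕ) :
    (-Nᵀ) ^ k = 0 ↔ N ^ k = 0 := by
  rw [neg_pow, ((isUnit_one.neg : IsUnit (-1 : Matrix (Fin e) (Fin e) ℝ)).pow k).mul_right_eq_zero,
    ← Matrix.transpose_pow, Matrix.transpose_eq_zero]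

/-- **The adjoint pencil.** If `{E,F}` has the Weierstraß–Kronecker decomposition
`(d, L, K, W, N)`, then the adjoint pair `{-Eᵀ, Fᵀ}` is a regular pencil and
`(d, blockDiag(-I_d, I)·Kᵀ, Lᵀ, -Wᵀ, -Nᵀ)` is a Weierstraß–Kronecker decomposition of it;
in particular it has the same `d` and the same nilpotency index. -/
theorem adjoint_pencil_decomposition (m : ℕ) (E F : Matrix (Fin m) (Fin m) ℝ)
    (hreg : RegularPencil E F) (w : WKDecomp m E F) :
    RegularPencil (-E.transpose) F.transpose ∧
    IsUnit (blockDiag w.hde (-1 : Matrix (Fin w.d) (Fin w.d) ℝ)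
      (1 : Matrix (Fin w.e) (Fin w.e) ℝ) * w.K.transpose).det ∧
    IsUnit w.L.transpose.det ∧
    IsNilpotent (-w.N.transpose) ∧
    (blockDiag w.hde (-1 : Matrix (Fin w.d) (Fin w.d) ℝ)
        (1 : Matrix (Fin w.e) (Fin w.e) ℝ) * w.K.transpose)
      * (-E.transpose) * w.L.transpose = blockDiag w.hde 1 (-w.N.transpose) ∧
    (blockDiag w.hde (-1 : Matrix (Fin w.d) (Fin w.d) ℝ)
        (1 : Matrix (Fin w.e) (Fin w.e) ℝ) * w.K.transpose)
      * F.transpose * w.L.transpose = blockDiag w.hde (-w.W.transpose) 1 ∧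
    (∀ k : ℕ, (-w.N.transpose) ^ k = 0 ↔ w.N ^ k = 0) := by
  refine ⟨hreg.neg_transpose, ?_, ?_, ?_, ?_, ?_, neg_transpose_pow_eq_zero_iff w.N⟩
  · rw [Matrix.det_mul, Matrix.det_transpose]
    exact (isUnit_det_blockDiag_neg_one_one w.hde).mul w.hK
  · rw [Matrix.det_transpose]
    exact w.hL
  · obtain ⟨k, hk⟩ := w.hN
    exact ⟨k, (neg_transpose_pow_eq_zero_iff w.N k).2 hk⟩
  · have hE := congrArg Matrix.transpose w.hE
    simp only [Matrix.transpose_mul, transpose_blockDiag, Matrix.transpose_one] at hE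
    simp only [Matrix.mul_neg, Matrix.neg_mul, Matrix.mul_assoc]
    rw [hE, blockDiag_mul_blockDiag, neg_blockDiag]
    simp
  · have hF := congrArg Matrix.transpose w.hF
    simp only [Matrix.transpose_mul, transpose_blockDiag, Matrix.transpose_one] at hF
    simp only [Matrix.mul_assoc]
    rw [hF, blockDiag_mul_blockDiag]
    simp
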